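/- Let S be a numerical semigroup with 2·ν(S) ≥ m(S). Then S satisfies Wilf's conjecture, i.e. f(S) + 1 ≤ n(S)·ν(S). -/

import Mathlib

/-- A numerical semigroup: an additive submonoid of `ℕ` (containing `0`, closed under
addition) whose complement in `ℕ` is finite. -/
structure NumericalSemigroup where
  carrier : Set ℕ
  zero_mem : 0 ∈ carrier
  add_mem : ∀ ⦃a b : ℕ⦄, a ∈ carrier → b ∈ carrier → a + b ∈ carrier
  cofinite : (carrierᶜ : Set ℕ).Finite

namespace NumericalSemigroup

/-- The multiplicity `m(S)`: the smallest positive element of `S`. -/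
noncomputable def mult (S : NumericalSemigroup) : ℕ :=
  sInf {s : ℕ | s ∈ S.carrier ∧ 0 < s}

/-- The embedding dimension `ν(S)`: the cardinality of the (unique) minimal system of
generators of `S`, i.e. the least cardinality of a generating set. -/
noncomputable def embdim (S : NumericalSemigroup) : ℕ :=
  sInf {n : ℕ | ∃ G : Finset ℕ,
    S.carrier = (AddSubmonoid.closure (G : Set ℕ) : Set ℕ) ∧ G.card = n}

/-- The Frobenius number `f(S)`: the largest integer not belonging to `S`. -/
noncomputable def frob (S : NumericalSemigroup) : ℤ :=
  sSup {x : ℤ | ∀ s ∈ S.carrier, (s : ℤ) ≠ x}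

/-- `n(S)`: the number of elements of `S` smaller than the Frobenius number. -/
noncomputable def small (S : NumericalSemigroup) : ℕ :=
  {s : ℕ | s ∈ S.carrier ∧ (s : ℤ) < S.frob}.ncard

/-- The type `t(S)`: the number of pseudo-Frobenius numbers of `S`, i.e. integers
`x ∉ S` such that `x + s ∈ S` for every nonzero `s ∈ S`. -/
noncomputable def typ (S : NumericalSemigroup) : ℕ :=
  {x : ℤ | (∀ s ∈ S.carrier, (s : ℤ) ≠ x) ∧
    ∀ s ∈ S.carrier, 0 < s → ∃ u ∈ S.carrier, (u : ℤ) = x + s}.ncard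

/-- The `k`-th interval `I_k = [k·m, (k+1)·m - 1]` (for a given `m`). -/
def interval (m k : ℕ) : Set ℕ := Set.Ico (k * m) ((k + 1) * m)

/-- `n_k`: the number of elements of `S ∩ I_k` smaller than the Frobenius number. -/
noncomputable def nk (S : NumericalSemigroup) (k : ℕ) : ℕ :=
  {s : ℕ | s ∈ S.carrier ∩ interval S.mult k ∧ (s : ℤ) < S.frob}.ncard

/-- `L = ⌊f(S)/m(S)⌋`. -/
noncomputable def Lindex (S : NumericalSemigroup) : ℤ := S.frob / (S.mult : ℤ)

/-- `ρ = f(S) + 1 - L·m(S)`. -/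
noncomputable def rho (S : NumericalSemigroup) : ℤ :=
  S.frob + 1 - S.Lindex * (S.mult : ℤ)

/-- The Apéry set `Ap(S) = {w ∈ S : w - m(S) ∉ S}`. -/
def apery (S : NumericalSemigroup) : Set ℕ :=
  {w : ℕ | w ∈ S.carrier ∧ ∀ u ∈ S.carrier, u + S.mult ≠ w}

theorem apery_finite (S : NumericalSemigroup) : S.apery.Finite := by
  apply Set.Finite.subset ((Set.finite_Iio S.mult).union (S.cofinite.image (· + S.mult)))
  intro x hx
  by_cases h : x < S.mult
  · exact Or.inl h
  · refine Or.inr ⟨x - S.mult, fun hmem => hx.2 _ hmem (by omega), ?_⟩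
    show x - S.mult + S.mult = x
    omega

/-- `w j`: the `(j+1)`-st smallest element of the Apéry set, so that
`Ap(S) = {w 0 < w 1 < ... < w (m-1)}` with `w 0 = 0`. -/
noncomputable def w (S : NumericalSemigroup) (j : ℕ) : ℕ :=
  (S.apery_finite.toFinset.sort (· ≤ ·)).getD j 0

/-- `ε_j`: the number of `k ∈ {0, ..., L-1}` such that `|I_k ∩ S| = j`. -/
noncomputable def eps (S : NumericalSemigroup) (j : ℕ) : ℕ :=
  {k : ℕ | (k : ℤ) < S.Lindex ∧ (S.carrier ∩ interval S.mult k).ncard = j}.ncard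

/-- `η_j`: the number of `k ∈ ℕ` such that `|I_k ∩ S| = j`. -/
noncomputable def eta (S : NumericalSemigroup) (j : ℕ) : ℕ :=
  {k : ℕ | (S.carrier ∩ interval S.mult k).ncard = j}.ncard

/-- Basic property of a pair of Apery elements whose sum is an Apery element. -/
theorem pair_aux (m q r c x y gx gy a b : ℕ) (hc : c + r = q * m) (hr : r < m)
    (hx : gx * m + x = c + a) (hy : gy * m + y = c + b) (ha : a < m) (hb : b < m)
    (hmx : m < x) (hmy : m < y) (hxy : x + y < c + m) :
    1 ≤ gx ∧ 1 ≤ gy ∧ q ≤ gx + gy + 1 ∧ (gx + gy + 1 = q → a + b + 1 ≤ r) := by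
  have h1 : 1 ≤ gx := by
    rcases Nat.eq_zero_or_pos gx with h | h
    · subst h; simp at hx; omega
    · exact h
  have h2 : 1 ≤ gy := by
    rcases Nat.eq_zero_or_pos gy with h | h
    · subst h; simp at hy; omega
    · exact h
  refine ⟨h1, h2, ?_, ?_⟩
  · by_contra hlt
    have h3 : (gx + gy + 2) * m ≤ q * m := Nat.mul_le_mul_right m (by omega)
    have h4 : (gx + gy + 2) * m = gx * m + gy * m + 2 * m := by ring
    omega
  · rintro rfl
    have h4 : (gx + gy + 1) * m = gx * m + gy * m + m := by ring
    omega

theorem mod_aux (m x y gx gy c a : ℕ) (hx : gx * m + x = c + a) (hy : gy * m + y = c + a) :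
    x % m = y % m := by
  have h1 : (gx * m + x) % m = x % m := by
    rw [add_comm]; exact Nat.add_mul_mod_self_right x gx m
  have h2 : (gy * m + y) % m = y % m := by
    rw [add_comm]; exact Nat.add_mul_mod_self_right y gy m
  rw [← h1, ← h2, hx, hy]

theorem core (m q r c p : ℕ) (A D : Finset ℕ) (g : ℕ → ℕ)
    (hc : c + r = q * m) (hr : r < m)
    (hA : A.card + 1 = m)
    (hmod : ∀ x ∈ A, ∀ y ∈ A, x % m = y % m → x = y)
    (hDA : D ⊆ A) (hD : ∀ d ∈ D, ∃ x ∈ A, ∃ y ∈ A, x + y = d)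
    (hAm : ∀ x ∈ A, m < x) (hAc : ∀ x ∈ A, x < c + m)
    (hg : ∀ x ∈ A, ∃ a < m, g x * m + x = c + a)
    (hp : p + D.card = m) (hDp : D.card ≤ p) :
    c ≤ (q + ∑ x ∈ A, g x) * p := by
  set N := ∑ x ∈ A, g x with hN
  suffices h : q * D.card ≤ p * N + r by
    have h1 : q * m = q * p + q * D.card := by rw [← hp]; ring
    have h2 : (q + N) * p = q * p + p * N := by ring
    omega
  by_cases hNq : q ≤ N
  · have : q * D.card ≤ N * p := Nat.mul_le_mul hNq hDp
    rw [mul_comm p N]; omega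
  rw [not_le] at hNq
  have one_le : ∀ x ∈ A, g x ≤ N := fun x hx =>
    Finset.single_le_sum (f := g) (fun _ _ => Nat.zero_le _) hx
  have two_le : ∀ x ∈ A, ∀ y ∈ A, x ≠ y → g x + g y ≤ N := by
    intro x hx y hy hxy
    rw [← Finset.sum_pair (f := g) hxy]
    exact Finset.sum_le_sum_of_subset (by
      intro z hz; simp at hz; rcases hz with rfl | rfl <;> assumption)
  have three_le : ∀ x ∈ A, ∀ y ∈ A, ∀ z ∈ A, x ≠ y → x ≠ z → y ≠ z →
      g x + g y + g z ≤ N := by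
    intro x hx y hy z hz hxy hxz hyz
    have : ∑ t ∈ ({x, y, z} : Finset ℕ), g t = g x + g y + g z := by
      rw [Finset.sum_insert (by simp [hxy, hxz]), Finset.sum_pair hyz]; ring
    rw [← this]
    exact Finset.sum_le_sum_of_subset (by
      intro t ht; simp at ht; rcases ht with rfl | rfl | rfl <;> assumption)
  choose! a ham hga using hg
  have pr : ∀ x ∈ A, ∀ y ∈ A, x + y ∈ D → 1 ≤ g x ∧ 1 ≤ g y ∧ q ≤ g x + g y + 1 ∧
      (g x + g y + 1 = q → a x + a y + 1 ≤ r) := fun x hx y hy hxy =>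
    pair_aux m q r c x y _ _ _ _ hc hr (hga x hx) (hga y hy) (ham x hx) (ham y hy)
      (hAm x hx) (hAm y hy) (hAc _ (hDA hxy))
  have ane : ∀ x ∈ A, ∀ y ∈ A, x ≠ y → a x ≠ a y := by
    intro x hx y hy hxy h
    exact hxy (hmod x hx y hy (mod_aux m x y _ _ c (a x) (hga x hx) (by rw [h]; exact hga y hy)))
  by_cases hcase : ∃ x ∈ A, ∃ y ∈ A, x ≠ y ∧ x + y ∈ D
  · obtain ⟨x, hx, y, hy, hxy, hd⟩ := hcase
    obtain ⟨g1, g2, g3, g4⟩ := pr x hx y hy hd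
    have hs := two_le x hx y hy hxy
    have hq : g x + g y + 1 = q := by omega
    have hNe : N + 1 = q := by omega
    have hr1 := g4 hq
    have hne := ane x hx y hy hxy
    have honly : ∀ z ∈ A, 1 ≤ g z → z = x ∨ z = y := by
      intro z hz hgz
      by_contra hcon
      push Not at hcon
      have := three_le x hx y hy z hz hxy hcon.1.symm hcon.2.symm
      omega
    have hsub : D ⊆ {x + x, x + y, y + y} := by
      intro d hd'
      obtain ⟨u, hu, v, hv, rfl⟩ := hD d hd'
      obtain ⟨k1, k2, -, -⟩ := pr u hu v hv hd'
      rcases honly u hu k1 with rfl | rfl <;> rcases honly v hv k2 with rfl | rfl <;>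
        simp [add_comm]
    have hD3 : D.card ≤ 3 := (Finset.card_le_card hsub).trans Finset.card_le_three
    have hD1 : 1 ≤ D.card := Finset.card_pos.mpr ⟨_, hd⟩
    have hA2 : 2 ≤ A.card := by
      rw [← Finset.card_pair hxy]
      exact Finset.card_le_card (by
        intro z hz; simp at hz; rcases hz with rfl | rfl <;> assumption)
    have hN2 : 2 ≤ N := by omega
    rcases Nat.lt_or_ge D.card p with hlt | hge
    · have h1 : (D.card + 1) * N ≤ p * N := Nat.mul_le_mul_right N hlt
      have h2 : q * D.card = D.card * N + D.card := by rw [← hNe]; ring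
      have h3 : (D.card + 1) * N = D.card * N + N := by ring
      omega
    · have hpe : p = D.card := by omega
      suffices D.card ≤ r by
        have h2 : q * D.card = D.card * N + D.card := by rw [← hNe]; ring
        rw [hpe]; omega
      by_contra hlt
      have hD3' : D.card = 3 := by omega
      have hr2 : r = 2 := by omega
      have hm6 : m = 6 := by omega
      have hDeq : D = {x + x, x + y, y + y} :=
        Finset.eq_of_subset_of_card_le hsub (by rw [hD3']; exact Finset.card_le_three)
      have hxx : x + x ∈ D := by rw [hDeq]; simp
      have hyy : y + y ∈ D := by rw [hDeq]; simp
      have e1 := hga x hx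
      have e2 := hga y hy
      have b1 := hAc _ (hDA hxx)
      have b2 := hAc _ (hDA hyy)
      have m1 := hmod x hx (y + y) (hDA hyy)
      have m2 := hmod y hy (x + x) (hDA hxx)
      have p1 := hAm x hx
      have p2 := hAm y hy
      clear_value N
      subst hm6
      have : (a x = 0 ∧ a y = 1) ∨ (a x = 1 ∧ a y = 0) := by omega
      rcases this with ⟨h1, h2⟩ | ⟨h1, h2⟩
      · have := m1 (by omega)
        omega
      · have := m2 (by omega)
        omega
  · push Not at hcase
    have hdbl : ∀ d ∈ D, ∃ x ∈ A, x + x = d := by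
      intro d hd
      obtain ⟨u, hu, v, hv, rfl⟩ := hD d hd
      by_cases huv : u = v
      · subst huv; exact ⟨u, hu, rfl⟩
      · exact absurd hd (hcase u hu v hv huv)
    choose! f hfA hf using hdbl
    have fp : ∀ d ∈ D, 1 ≤ g (f d) ∧ q ≤ 2 * g (f d) + 1 ∧
        (2 * g (f d) + 1 = q → 2 * a (f d) + 1 ≤ r) := by
      intro d hd
      obtain ⟨h1, -, h3, h4⟩ := pr (f d) (hfA d hd) (f d) (hfA d hd) (by rw [hf d hd]; exact hd)
      exact ⟨h1, by omega, fun h => by have := h4 (by omega); omega⟩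
    have finj : ∀ d ∈ D, ∀ e ∈ D, d ≠ e → f d ≠ f e := by
      intro d hd e he hde h
      apply hde; rw [← hf d hd, ← hf e he, h]
    rcases Nat.lt_or_ge 2 D.card with h3 | h3
    · obtain ⟨d, e, k, hd, he, hk, hde, hdk, hek⟩ := Finset.two_lt_card_iff.mp h3
      have := three_le _ (hfA d hd) _ (hfA e he) _ (hfA k hk) (finj d hd e he hde)
        (finj d hd k hk hdk) (finj e he k hk hek)
      have := fp d hd
      have := fp e he
      have := fp k hk
      omega
    rcases Nat.lt_or_ge 1 D.card with h2 | h2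
    · obtain ⟨d, hd, e, he, hde⟩ := Finset.one_lt_card.mp h2
      have hs := two_le _ (hfA d hd) _ (hfA e he) (finj d hd e he hde)
      have hne := ane _ (hfA d hd) _ (hfA e he) (finj d hd e he hde)
      have f1 := fp d hd
      have f2 := fp e he
      have hD2 : D.card = 2 := by omega
      rw [hD2]
      rcases Nat.lt_or_ge 2 p with hp3 | hp3
      · have : 3 * N ≤ p * N := Nat.mul_le_mul_right N hp3
        omega
      · have : p = 2 := by omega
        rw [this]
        omega
    rcases Nat.eq_zero_or_pos D.card with h1 | h1
    · rw [h1]; simp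
    · obtain ⟨d, hd⟩ := Finset.card_pos.mp h1
      have hD1 : D.card = 1 := by omega
      have f1 := fp d hd
      have hs := one_le _ (hfA d hd)
      have hA2 : 2 ≤ A.card := by
        have : f d ≠ d := by have := hf d hd; have := hAm _ (hfA d hd); omega
        rw [← Finset.card_pair this]
        exact Finset.card_le_card (by
          intro z hz; simp at hz; rcases hz with rfl | rfl
          · exact hfA d hd
          · exact hDA hd)
      rw [hD1]
      rcases Nat.lt_or_ge 2 p with hp3 | hp3
      · have : 3 * N ≤ p * N := Nat.mul_le_mul_right N hp3
        omega
      · have : p = 2 := by omega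
        rw [this]
        omega

theorem frob_spec (S : NumericalSemigroup) :
    (∀ s ∈ S.carrier, (s : ℤ) ≠ S.frob) ∧ ∀ n : ℕ, S.frob < n → n ∈ S.carrier := by
  have hb : BddAbove {x : ℤ | ∀ s ∈ S.carrier, (s : ℤ) ≠ x} := by
    obtain ⟨B, hB⟩ := S.cofinite.bddAbove
    refine ⟨B, fun x hx => ?_⟩
    by_contra hlt
    push Not at hlt
    have hx0 : 0 ≤ x := by omega
    lift x to ℕ using hx0
    have : x ∈ (S.carrierᶜ : Set ℕ) := fun h => hx x h rfl
    have := hB this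
    omega
  have hne : {x : ℤ | ∀ s ∈ S.carrier, (s : ℤ) ≠ x}.Nonempty :=
    ⟨-1, fun s _ => by omega⟩
  refine ⟨Int.csSup_mem hne hb, fun n hn => ?_⟩
  by_contra h
  have : (n : ℤ) ≤ S.frob := le_csSup hb (fun s hs he => h (by
    have : s = n := by exact_mod_cast he
    rwa [← this]))
  omega

theorem mult_spec (S : NumericalSemigroup) :
    S.mult ∈ S.carrier ∧ 0 < S.mult ∧ ∀ s ∈ S.carrier, 0 < s → S.mult ≤ s := by
  have hne : {s : ℕ | s ∈ S.carrier ∧ 0 < s}.Nonempty := by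
    refine ⟨S.frob.toNat + 1, (frob_spec S).2 _ (by omega), by omega⟩
  have h := Nat.sInf_mem hne
  exact ⟨h.1, h.2, fun s hs h0 => Nat.sInf_le ⟨hs, h0⟩⟩

theorem add_mul_mem (S : NumericalSemigroup) {s : ℕ} (hs : s ∈ S.carrier) (k : ℕ) :
    s + k * S.mult ∈ S.carrier := by
  induction k with
  | zero => simpa using hs
  | succ k ih =>
    have := S.add_mem ih (mult_spec S).1
    rwa [show s + (k + 1) * S.mult = s + k * S.mult + S.mult by ring]

theorem apery_mod (S : NumericalSemigroup) {x y : ℕ} (hx : x ∈ S.apery) (hy : y ∈ S.apery)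
    (h : x % S.mult = y % S.mult) : x = y := by
  have key : ∀ x ∈ S.apery, ∀ y ∈ S.apery, x % S.mult = y % S.mult → x < y → False := by
    intro x hx y hy h hlt
    obtain ⟨k, hk⟩ := (Nat.modEq_iff_dvd' hlt.le).mp h
    have hk0 : k ≠ 0 := by rintro rfl; simp at hk; omega
    obtain ⟨j, rfl⟩ := Nat.exists_eq_succ_of_ne_zero hk0
    refine hy.2 _ (add_mul_mem S hx.1 j) ?_
    have : S.mult * (j + 1) = j * S.mult + S.mult := by ring
    simp only [Nat.succ_eq_add_one] at hk
    omega
  rcases lt_trichotomy x y with h1 | h1 | h1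
  · exact (key x hx y hy h h1).elim
  · exact h1
  · exact (key y hy x hx h.symm h1).elim

theorem apery_card (S : NumericalSemigroup) : S.apery_finite.toFinset.card = S.mult := by
  obtain ⟨hm, hm0, hmin⟩ := mult_spec S
  rw [← Finset.card_range S.mult]
  refine Finset.card_bij (fun x _ => x % S.mult) ?_ ?_ ?_
  · intro x _; simpa using Nat.mod_lt x hm0
  · intro x hx y hy h
    exact apery_mod S (by simpa using hx) (by simpa using hy) h
  · intro i hi
    have hi' : i < S.mult := by simpa using hi
    classical
    have hex : ∃ s, s ∈ S.carrier ∧ s % S.mult = i := by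
      refine ⟨i + (S.frob.toNat + 1) * S.mult, (frob_spec S).2 _ ?_, ?_⟩
      · have : (S.frob.toNat + 1) * 1 ≤ (S.frob.toNat + 1) * S.mult :=
          Nat.mul_le_mul_left _ hm0
        omega
      · rw [Nat.add_mul_mod_self_right, Nat.mod_eq_of_lt hi']
    have hs := Nat.find_spec hex
    refine ⟨Nat.find hex, ?_, hs.2⟩
    simp only [Set.Finite.mem_toFinset]
    refine ⟨hs.1, fun u hu he => ?_⟩
    refine Nat.find_min hex (m := u) (by omega) ⟨hu, ?_⟩
    rw [← hs.2, ← he, Nat.add_mod_right]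

open Classical in
/-- Nonzero Apery elements. -/
noncomputable def apA (S : NumericalSemigroup) : Finset ℕ := S.apery_finite.toFinset.erase 0

open Classical in
/-- Decomposable Apery elements. -/
noncomputable def apD (S : NumericalSemigroup) : Finset ℕ :=
  S.apA.filter (fun d => ∃ x ∈ S.apA, ∃ y ∈ S.apA, x + y = d)

theorem mem_apA (S : NumericalSemigroup) (x : ℕ) : x ∈ S.apA ↔ x ≠ 0 ∧ x ∈ S.apery := by
  simp [apA]

theorem zero_apery (S : NumericalSemigroup) : 0 ∈ S.apery :=
  ⟨S.zero_mem, fun u _ h => by have := (mult_spec S).2.1; omega⟩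

theorem apA_card (S : NumericalSemigroup) : S.apA.card + 1 = S.mult := by
  classical
  rw [← apery_card S, apA]
  exact Finset.card_erase_add_one (by simpa using zero_apery S)

theorem mult_lt_apA (S : NumericalSemigroup) {x : ℕ} (hx : x ∈ S.apA) : S.mult < x := by
  rw [mem_apA] at hx
  have h1 := (mult_spec S).2.2 x hx.2.1 (by omega)
  have h2 := hx.2.2 0 S.zero_mem
  omega

theorem irred_mem (S : NumericalSemigroup) (G : Finset ℕ)
    (hG : S.carrier = (AddSubmonoid.closure (G : Set ℕ) : Set ℕ)) (x : ℕ) (hx : x ∈ S.carrier)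
    (hx0 : x ≠ 0) (hirr : ∀ u ∈ S.carrier, ∀ v ∈ S.carrier, u ≠ 0 → v ≠ 0 → u + v ≠ x) :
    x ∈ G := by
  have hx' : x ∈ AddSubmonoid.closure (G : Set ℕ) := by
    have := hx; rw [hG] at this; exact this
  have key : ∀ y ∈ AddSubmonoid.closure (G : Set ℕ), y = x → x ∈ G := by
    intro y hy
    induction hy using AddSubmonoid.closure_induction with
    | mem y hy => rintro rfl; exact hy
    | zero => intro h; exact absurd h.symm hx0
    | add u v hu hv ihu ihv =>
      intro h
      by_cases hu0 : u = 0
      · exact ihv (by omega)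
      by_cases hv0 : v = 0
      · exact ihu (by omega)
      exact absurd h (hirr u (by rw [hG]; exact hu) v (by rw [hG]; exact hv) hu0 hv0)
  exact key x hx' rfl

open Classical in
theorem embdim_eq (S : NumericalSemigroup) : S.embdim + S.apD.card = S.mult := by
  obtain ⟨hm, hm0, hmin⟩ := mult_spec S
  set P : Finset ℕ := insert S.mult (S.apA \ S.apD) with hP
  have hsub : S.apD ⊆ S.apA := Finset.filter_subset _ _
  have hPc : P.card + S.apD.card = S.mult := by
    rw [hP, Finset.card_insert_of_notMem, ← apA_card S, ← Finset.card_sdiff_add_card_eq_card hsub]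
    · ring
    · intro h
      have := mult_lt_apA S (Finset.mem_sdiff.mp h).1
      omega
  have hgen : S.carrier = (AddSubmonoid.closure (P : Set ℕ) : Set ℕ) := by
    ext s
    constructor
    · induction s using Nat.strong_induction_on with
      | _ s ih =>
      intro hs
      by_cases h0 : s = 0
      · subst h0; exact AddSubmonoid.zero_mem _
      by_cases hap : s ∈ S.apery
      · have hsA : s ∈ S.apA := (mem_apA S s).mpr ⟨h0, hap⟩
        by_cases hsD : s ∈ S.apD
        · obtain ⟨-, x, hx, y, hy, rfl⟩ := Finset.mem_filter.mp hsD
          have hx' := (mem_apA S x).mp hx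
          have hy' := (mem_apA S y).mp hy
          exact AddSubmonoid.add_mem _ (ih x (by omega) hx'.2.1) (ih y (by omega) hy'.2.1)
        · exact AddSubmonoid.subset_closure (by simp [hP, hsA, hsD])
      · have : ∃ u ∈ S.carrier, u + S.mult = s := by
          by_contra hcon
          push Not at hcon
          exact hap ⟨hs, hcon⟩
        obtain ⟨u, hu, rfl⟩ := this
        exact AddSubmonoid.add_mem _ (ih u (by omega) hu)
          (AddSubmonoid.subset_closure (by simp [hP]))
    · intro hs
      have hs' : s ∈ AddSubmonoid.closure (P : Set ℕ) := hs
      induction hs' using AddSubmonoid.closure_induction with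
      | mem y hy =>
        simp only [hP, Finset.coe_insert, Set.mem_insert_iff, Finset.mem_coe,
          Finset.mem_sdiff] at hy
        rcases hy with rfl | hy
        · exact hm
        · exact ((mem_apA S y).mp hy.1).2.1
      | zero => exact S.zero_mem
      | add u v hu hv ihu ihv => exact S.add_mem (ihu hu) (ihv hv)
  have hle : S.embdim ≤ P.card := Nat.sInf_le ⟨P, hgen, rfl⟩
  have hge : P.card ≤ S.embdim := by
    obtain ⟨G, hG, hGc⟩ := Nat.sInf_mem (s := {n : ℕ | ∃ G : Finset ℕ,
      S.carrier = (AddSubmonoid.closure (G : Set ℕ) : Set ℕ) ∧ G.card = n}) ⟨_, P, hgen, rfl⟩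
    have hGc' : G.card = S.embdim := hGc
    rw [← hGc']
    apply Finset.card_le_card
    intro x hx
    simp only [hP, Finset.mem_insert, Finset.mem_sdiff] at hx
    rcases hx with rfl | ⟨hxA, hxD⟩
    · refine irred_mem S G hG _ hm (by omega) fun u hu v hv hu0 hv0 he => ?_
      have := hmin u hu (by omega)
      omega
    · have hx' := (mem_apA S x).mp hxA
      refine irred_mem S G hG _ hx'.2.1 hx'.1 fun u hu v hv hu0 hv0 he => ?_
      apply hxD
      refine Finset.mem_filter.mpr ⟨hxA, u, (mem_apA S u).mpr ⟨hu0, hu, ?_⟩, v,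
        (mem_apA S v).mpr ⟨hv0, hv, ?_⟩, he⟩
      · intro t ht hte
        exact hx'.2.2 (t + v) (S.add_mem ht hv) (by omega)
      · intro t ht hte
        exact hx'.2.2 (u + t) (S.add_mem hu ht) (by omega)
  omega

theorem small_ge (S : NumericalSemigroup) (c : ℕ) (hc : S.frob + 1 = c) :
    ∑ x ∈ S.apery_finite.toFinset, (c + S.mult - 1 - x) / S.mult ≤ S.small := by
  obtain ⟨hm, hm0, hmin⟩ := mult_spec S
  have hfin : {s : ℕ | s ∈ S.carrier ∧ (s : ℤ) < S.frob}.Finite :=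
    (Set.finite_Iio c).subset (fun s hs => by
      have := hs.2
      simp only [Set.mem_Iio]; omega)
  rw [small, Set.ncard_eq_toFinset_card _ hfin]
  have : ∑ x ∈ S.apery_finite.toFinset, (c + S.mult - 1 - x) / S.mult
      = (S.apery_finite.toFinset.sigma
          (fun x => Finset.range ((c + S.mult - 1 - x) / S.mult))).card := by
    simp
  rw [this]
  refine Finset.card_le_card_of_injOn (fun z => z.1 + z.2 * S.mult) ?_ ?_
  · rintro ⟨x, k⟩ hz
    simp only [Finset.coe_sigma, Set.mem_sigma_iff, Finset.mem_coe, Set.Finite.mem_toFinset,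
      Finset.mem_range] at hz
    obtain ⟨hx, hk⟩ := hz
    have hmem := add_mul_mem S hx.1 k
    have h1 : (k + 1) * S.mult ≤ c + S.mult - 1 - x := by
      exact (Nat.le_div_iff_mul_le hm0).mp hk
    have h2 : (k + 1) * S.mult = k * S.mult + S.mult := by ring
    have h3 : x + k * S.mult < c := by omega
    have h4 := (frob_spec S).1 _ hmem
    simp only [Set.Finite.coe_toFinset, Set.mem_setOf_eq]
    refine ⟨hmem, ?_⟩
    push_cast at h4 ⊢
    have h5 : ((x + k * S.mult : ℕ) : ℤ) < c := by exact_mod_cast h3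
    push_cast at h5
    omega
  · rintro ⟨x, k⟩ hz ⟨y, l⟩ hw h
    simp only [Finset.coe_sigma, Set.mem_sigma_iff, Finset.mem_coe, Set.Finite.mem_toFinset,
      Finset.mem_range] at hz hw
    simp only at h
    have hxy : x = y := by
      apply apery_mod S hz.1 hw.1
      rw [← Nat.add_mul_mod_self_right x k S.mult, h, Nat.add_mul_mod_self_right]
    subst hxy
    have : k * S.mult = l * S.mult := by omega
    have := Nat.eq_of_mul_eq_mul_right hm0 this
    subst this
    rfl

/-- If `2ν(S) ≥ m(S)` then `S` satisfies Wilf's conjecture. -/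
theorem wilf_of_two_embdim_ge_mult (S : NumericalSemigroup)
    (h : 2 * S.embdim ≥ S.mult) :
    S.frob + 1 ≤ (S.small : ℤ) * (S.embdim : ℤ) := by
  classical
  rcases lt_or_ge S.frob 0 with hneg | hpos
  · have : (0 : ℤ) ≤ (S.small : ℤ) * (S.embdim : ℤ) := by positivity
    omega
  obtain ⟨c, hc⟩ : ∃ c : ℕ, S.frob + 1 = c := ⟨(S.frob + 1).toNat, by omega⟩
  obtain ⟨hm, hm0, hmin⟩ := mult_spec S
  have hsm := small_ge S c hc
  have hemb := embdim_eq S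
  have hdiv : ∀ x, x < c + S.mult →
      ∃ a < S.mult, (c + S.mult - 1 - x) / S.mult * S.mult + x = c + a := by
    intro x hx
    have h1 := Nat.div_add_mod (c + S.mult - 1 - x) S.mult
    have h2 := Nat.mod_lt (c + S.mult - 1 - x) hm0
    rw [mul_comm] at h1
    exact ⟨S.mult - 1 - (c + S.mult - 1 - x) % S.mult, by omega, by omega⟩
  obtain ⟨r, hr, hq⟩ := hdiv 0 (by omega)
  have hcore := core S.mult ((c + S.mult - 1 - 0) / S.mult) r c S.embdim S.apA S.apD
    (fun x => (c + S.mult - 1 - x) / S.mult) (by omega) hr (apA_card S)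
    (fun x hx y hy => apery_mod S ((mem_apA S x).mp hx).2 ((mem_apA S y).mp hy).2)
    (Finset.filter_subset _ _) (fun d hd => (Finset.mem_filter.mp hd).2)
    (fun x hx => mult_lt_apA S hx)
    (by
      intro x hx
      by_contra hlt
      have hx' := (mem_apA S x).mp hx
      exact hx'.2.2 (x - S.mult) ((frob_spec S).2 _ (by omega)) (by omega))
    (by
      intro x hx
      apply hdiv
      by_contra hlt
      have hx' := (mem_apA S x).mp hx
      exact hx'.2.2 (x - S.mult) ((frob_spec S).2 _ (by omega)) (by omega))
    hemb (by omega)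
  have hsum : (c + S.mult - 1 - 0) / S.mult + ∑ x ∈ S.apA, (c + S.mult - 1 - x) / S.mult
      = ∑ x ∈ S.apery_finite.toFinset, (c + S.mult - 1 - x) / S.mult := by
    rw [apA]
    exact Finset.add_sum_erase _ (fun x => (c + S.mult - 1 - x) / S.mult)
      (by simpa using zero_apery S)
  rw [hsum] at hcore
  have := hcore.trans (Nat.mul_le_mul_right _ hsm)
  rw [hc]
  exact_mod_cast this

end NumericalSemigroup
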